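/- Let μ^N be the unique invariant measure of the silo process of width N, each extended to [0,∞)^ℤ by setting the configuration equal to 0 outside Λ^N. Then for every N ≥ 3 one has the stochastic dominations τ_1 μ^{N−2} ≤_st μ^N ≤_st μ^{N+2} and τ_1 μ^{N−2} ≤_st τ_1 μ^N ≤_st μ^{N+2}, where τ_1 is the shift (τ_1 W)(i) = W(i−1) and μ ≤_st μ' means ∫ f dμ ≤ ∫ f dμ' for every bounded measurable coordinatewise nondecreasing function f on [0,∞)^ℤ. -/

import Mathlib

open MeasureTheory ProbabilityTheory Filter

noncomputable section

/-- The uniform distribution on `[0,1]`. -/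
def unif01 : Measure ℝ := volume.restrict (Set.Icc (0:ℝ) 1)

/-- Truncation of a configuration to the box `Λ^N = {1,…,N}` (zero outside). -/
def trunc (N : ℕ) (w : ℤ → ℝ) : ℤ → ℝ :=
  fun i => if 1 ≤ i ∧ i ≤ (N : ℤ) then w i else 0

/-- One step of the width-`N` silo dynamics with fractions `u` and added weights `v`. -/
def siloStep (N : ℕ) (u v w : ℤ → ℝ) : ℤ → ℝ :=
  trunc N fun i => v i + trunc N w (i + 1) * u (i + 1) + trunc N w (i - 1) * (1 - u (i - 1))

/-- `ν` is the product measure on `ℤ → ℝ` with all marginals `m`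
(characterized through its finite-dimensional distributions). -/
def IsProductLaw (m : Measure ℝ) (ν : Measure (ℤ → ℝ)) : Prop :=
  IsProbabilityMeasure ν ∧
    ∀ I : Finset ℤ, ν.map (fun w (i : I) => w (i : ℤ)) = Measure.pi fun _ : I => m

/-- The law on `ℤ → ℝ` which is iid `m` on the finite window `I` and `0` elsewhere. -/
def finExtLaw (I : Finset ℤ) (m : Measure ℝ) : Measure (ℤ → ℝ) :=
  (Measure.pi fun _ : I => m).map fun f i => if h : i ∈ I then f ⟨i, h⟩ else 0

/-- Law of the pair (fractions, weights) driving one step of the width-`N` silo. -/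
def siloDriveLaw (N : ℕ) (νV : Measure ℝ) : Measure ((ℤ → ℝ) × (ℤ → ℝ)) :=
  (finExtLaw (Finset.Icc 0 ((N : ℤ) + 1)) unif01).prod (finExtLaw (Finset.Icc 1 (N : ℤ)) νV)

/-- `μ` is carried by the state space `[0,∞)^{Λ^N}`. -/
def SiloSupported (N : ℕ) (μ : Measure (ℤ → ℝ)) : Prop :=
  μ {w | ∀ i : ℤ, 0 ≤ w i ∧ (¬(1 ≤ i ∧ i ≤ (N : ℤ)) → w i = 0)} = 1

/-- Hypotheses on the common law of the grain weights `V_t(i)`: a probability measure on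
`[0,∞)` with mean `1` and finite variance. -/
def IsVLaw (νV : Measure ℝ) : Prop :=
  IsProbabilityMeasure νV ∧ νV {x | x < 0} = 0 ∧ (∫ x, x ∂νV) = 1 ∧
    Integrable (fun x => x ^ 2) νV

/-- `μ` is an invariant probability measure for the width-`N` silo process. -/
def IsSiloInvariant (N : ℕ) (νV : Measure ℝ) (μ : Measure (ℤ → ℝ)) : Prop :=
  IsProbabilityMeasure μ ∧ SiloSupported N μ ∧
    (μ.prod (siloDriveLaw N νV)).map (fun p => siloStep N p.2.1 p.2.2 p.1) = μ

/-- The law of the silo process at time `t`, started from the distribution `μ0`. -/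
def siloChainLaw (N : ℕ) (νV : Measure ℝ) (μ0 : Measure (ℤ → ℝ)) : ℕ → Measure (ℤ → ℝ)
  | 0 => μ0
  | t + 1 =>
      ((siloChainLaw N νV μ0 t).prod (siloDriveLaw N νV)).map
        fun p => siloStep N p.2.1 p.2.2 p.1

/-- One step of the infinite silo model with fractions `u`. -/
def ismStep (u η : ℤ → ℝ) : ℤ → ℝ :=
  fun i => η (i - 1) * u (i - 1) + η (i + 1) * (1 - u (i + 1))

/-- `ν` is invariant for the infinite silo model. -/
def IsISMInvariant (ν : Measure (ℤ → ℝ)) : Prop :=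
  ∀ κ : Measure (ℤ → ℝ), IsProductLaw unif01 κ →
    ((ν.prod κ).map fun p => ismStep p.2 p.1) = ν

/-- The shift `τ_1` on configurations. -/
def shift1 (η : ℤ → ℝ) : ℤ → ℝ := fun i => η (i - 1)

/-- `ν` plays the role of `ν_ρ`: the product of Gamma(2, 2/ρ) laws for `ρ ≠ 0`,
and the point mass at the zero configuration for `ρ = 0`. -/
def IsNuRho (ρ : ℝ) (ν : Measure (ℤ → ℝ)) : Prop :=
  (ρ = 0 → ν = Measure.dirac fun _ => 0) ∧
    (ρ ≠ 0 → IsProductLaw (gammaMeasure 2 (2 / ρ)) ν)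


/-- Stochastic domination: `μ ≤st μ'` iff `∫ f dμ ≤ ∫ f dμ'` for every bounded measurable
coordinatewise nondecreasing `f`. -/
def StochLE (μ μ' : Measure (ℤ → ℝ)) : Prop :=
  ∀ f : (ℤ → ℝ) → ℝ, Measurable f → (∃ C : ℝ, ∀ w, |f w| ≤ C) →
    (∀ w w' : ℤ → ℝ, (∀ i, w i ≤ w' i) → f w ≤ f w') →
      (∫ w, f w ∂μ) ≤ ∫ w, f w ∂μ'

open scoped Pointwise in
/-- Domination of all closed up-sets, up to arbitrarily small vertical shifts and errors, is
enough for stochastic domination. -/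
theorem StochLE.of_approx_coupling {μ μ' : Measure (ℤ → ℝ)} [IsProbabilityMeasure μ]
    [IsProbabilityMeasure μ']
    (h : ∀ ε : ℝ, 0 < ε → ∀ δ : ENNReal, 0 < δ → ∃ π : Measure ((ℤ → ℝ) × (ℤ → ℝ)),
      π.map Prod.fst = μ ∧ π.map Prod.snd = μ' ∧
        π {p | ¬ ∀ i, p.1 i ≤ p.2 i + ε} ≤ δ) :
    StochLE μ μ' := by
  have hclosed : ∀ F : Set (ℤ → ℝ), IsClosed F → IsUpperSet F → μ F ≤ μ' F := by
    intro F hF hup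
    have hadd : ∀ ε : ℝ, Measurable fun (w : ℤ → ℝ) i => w i + ε := fun ε => by fun_prop
    have hε : ∀ ε : ℝ, 0 < ε → μ F ≤ μ' {w | (fun i => w i + ε) ∈ F} := by
      intro ε hε
      refine ENNReal.le_of_forall_pos_le_add fun δ hδ _ => ?_
      obtain ⟨π, h1, h2, h3⟩ := h ε hε δ (by exact_mod_cast hδ)
      have hFε : MeasurableSet {w : ℤ → ℝ | (fun i => w i + ε) ∈ F} := hadd ε hF.measurableSet
      rw [← h1, ← h2, Measure.map_apply measurable_fst hF.measurableSet,
        Measure.map_apply measurable_snd hFε]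
      refine le_trans (measure_mono ?_) ((measure_union_le _ _).trans (by gcongr))
      intro p hp
      by_cases hb : ∀ i, p.1 i ≤ p.2 i + ε
      · exact Or.inl (hup hb hp)
      · exact Or.inr hb
    have hlim := tendsto_measure_iInter_atTop (μ := μ')
      (s := fun n : ℕ => {w : ℤ → ℝ | (fun i => w i + 1 / ((n : ℝ) + 1)) ∈ F})
      (fun n => (hadd _ hF.measurableSet).nullMeasurableSet)
      (fun m n hmn w hw => hup (fun i => by
        have := Nat.one_div_le_one_div (α := ℝ) hmn
        simpa using this) hw) ⟨0, measure_ne_top _ _⟩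
    have hle := ge_of_tendsto' hlim fun n => hε _ Nat.one_div_pos_of_nat
    refine hle.trans (measure_mono fun w hw => ?_)
    rw [Set.mem_iInter] at hw
    refine hF.mem_of_tendsto (b := atTop) (f := fun (n : ℕ) i => w i + 1 / ((n : ℝ) + 1)) ?_
      (Eventually.of_forall hw)
    rw [tendsto_pi_nhds]
    intro i
    simpa using (tendsto_const_nhds (x := w i)).add
      (tendsto_one_div_add_atTop_nhds_zero_nat (𝕜 := ℝ))
  have hmeas : ∀ U : Set (ℤ → ℝ), MeasurableSet U → IsUpperSet U → μ U ≤ μ' U := by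
    intro U hU hup
    refine le_of_forall_lt fun r hr => ?_
    obtain ⟨K, hKU, hK, hrK⟩ := hU.exists_lt_isCompact_of_ne_top (measure_ne_top μ U) hr
    have hcl : IsClosed (K + Set.Ici (0 : ℤ → ℝ)) := isClosed_Ici.add_left_of_isCompact hK
    have hsub : K ⊆ K + Set.Ici (0 : ℤ → ℝ) := fun x hx => ⟨x, hx, 0, Set.mem_Ici.2 le_rfl, add_zero x⟩
    have hKup : IsUpperSet (K + Set.Ici (0 : ℤ → ℝ)) := by
      rintro _ b hb ⟨x, hx, y, hy, rfl⟩
      exact ⟨x, hx, b - x, sub_nonneg.2 ((le_add_of_nonneg_right hy).trans hb),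
        add_sub_cancel _ _⟩
    refine hrK.trans_le ((measure_mono hsub).trans ((hclosed _ hcl hKup).trans
      (measure_mono ?_)))
    rintro _ ⟨x, hx, y, hy, rfl⟩
    exact hup (le_add_of_nonneg_right hy) (hKU hx)
  intro f hf ⟨C, hC⟩ hmono
  have hint : ∀ (ν : Measure (ℤ → ℝ)) [IsProbabilityMeasure ν], Integrable f ν := fun ν _ =>
    Integrable.of_bound hf.aestronglyMeasurable C (Eventually.of_forall hC)
  have hnn : ∀ w, 0 ≤ f w + C := fun w => by linarith [neg_le_of_abs_le (hC w)]
  have hkey : (∫ w, f w + C ∂μ) ≤ ∫ w, f w + C ∂μ' := by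
    rw [integral_eq_lintegral_of_nonneg_ae (Eventually.of_forall hnn)
        (hf.add_const C).aestronglyMeasurable,
      integral_eq_lintegral_of_nonneg_ae (Eventually.of_forall hnn)
        (hf.add_const C).aestronglyMeasurable]
    refine ENNReal.toReal_mono ?_ ?_
    · exact ((hint μ').add (integrable_const C)).lintegral_lt_top.ne
    · rw [lintegral_eq_lintegral_meas_lt _ (Eventually.of_forall hnn)
          (hf.add_const C).aemeasurable,
        lintegral_eq_lintegral_meas_lt _ (Eventually.of_forall hnn)
          (hf.add_const C).aemeasurable]
      refine lintegral_mono fun t => hmeas _ ?_ ?_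
      · exact measurableSet_lt measurable_const (hf.add_const C)
      · intro a b hab ha
        have ha' : t < f a + C := ha
        exact ha'.trans_le (add_le_add_left (hmono a b hab) C)
  rw [integral_add (hint μ) (integrable_const C), integral_add (hint μ') (integrable_const C)]
    at hkey
  simpa using hkey

/-- The configuration `w` translated by `s` to the left and cut off outside `I`. -/
def windowShift (s : ℤ) (I : Finset ℤ) (w : ℤ → ℝ) : ℤ → ℝ :=
  fun i => if i ∈ I then w (i + s) else 0

@[fun_prop]
theorem measurable_windowShift (s : ℤ) (I : Finset ℤ) : Measurable (windowShift s I) := by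
  refine measurable_pi_iff.2 fun i => ?_
  unfold windowShift
  split_ifs <;> fun_prop

theorem measurable_finExt (I : Finset ℤ) :
    Measurable fun (f : I → ℝ) (i : ℤ) => if h : i ∈ I then f ⟨i, h⟩ else 0 := by
  refine measurable_pi_iff.2 fun i => ?_
  split_ifs <;> fun_prop

instance (I : Finset ℤ) (m : Measure ℝ) [IsProbabilityMeasure m] :
    IsProbabilityMeasure (finExtLaw I m) :=
  Measure.isProbabilityMeasure_map (measurable_finExt I).aemeasurable

theorem finExtLaw_map_windowShift {s : ℤ} {I J : Finset ℤ} (hIJ : ∀ i ∈ I, i + s ∈ J)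
    (m : Measure ℝ) [IsProbabilityMeasure m] :
    (finExtLaw J m).map (windowShift s I) = finExtLaw I m := by
  have hrestr : (Measure.pi fun _ : J => m).map
      (fun (f : J → ℝ) (i : I) => f ⟨i + s, hIJ i i.2⟩) = Measure.pi fun _ : I => m := by
    have hind : iIndepFun (fun (j : J) (f : J → ℝ) => f j) (Measure.pi fun _ : J => m) :=
      iIndepFun_pi (X := fun _ x => x) fun _ => aemeasurable_id
    have hinj : Function.Injective fun i : I => (⟨i + s, hIJ i i.2⟩ : J) := by
      intro a b hab
      exact Subtype.ext (add_right_cancel (Subtype.ext_iff.1 hab))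
    have hlaw := (iIndepFun_iff_map_fun_eq_pi_map (fun i =>
      (measurable_pi_apply _).aemeasurable)).1 (hind.precomp hinj)
    rw [hlaw]
    congr 1
    funext i
    exact (measurePreserving_eval (fun _ : J => m) _).map_eq
  rw [finExtLaw, finExtLaw, Measure.map_map (by fun_prop) (measurable_finExt J), ← hrestr,
    Measure.map_map (measurable_finExt I)
      (measurable_pi_lambda _ fun _ => measurable_pi_apply _)]
  congr 1
  funext f i
  simp only [Function.comp, windowShift]
  split_ifs with h1 h2
  · rfl
  · exact absurd (hIJ i h1) h2
  · rfl

theorem finExtLaw_map_eval {I : Finset ℤ} (m : Measure ℝ) [IsProbabilityMeasure m] {i : ℤ}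
    (hi : i ∈ I) : (finExtLaw I m).map (fun w => w i) = m := by
  rw [finExtLaw, Measure.map_map (by fun_prop) (measurable_finExt I)]
  simp only [Function.comp_def, hi, dite_true]
  exact (measurePreserving_eval (fun _ : I => m) ⟨i, hi⟩).map_eq

theorem ae_finExtLaw {I : Finset ℤ} {m : Measure ℝ} [IsProbabilityMeasure m] {p : ℝ → Prop}
    (hp : ∀ᵐ x ∂m, p x) (h0 : p 0) : ∀ᵐ w ∂finExtLaw I m, ∀ i, p (w i) := by
  refine ae_all_iff.2 fun i => ?_
  by_cases hi : i ∈ I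
  · rw [← finExtLaw_map_eval m hi] at hp
    exact ae_of_ae_map (measurable_pi_apply i).aemeasurable hp
  · have : ∀ᵐ w ∂finExtLaw I m, w i = 0 := by
      rw [finExtLaw, ae_map_iff (measurable_finExt I).aemeasurable
        (measurableSet_eq_fun (measurable_pi_apply i) measurable_const)]
      simp [hi]
    filter_upwards [this] with w hw
    rwa [hw]

instance : IsProbabilityMeasure unif01 := ⟨by simp [unif01]⟩

theorem ae_unif01 : ∀ᵐ x ∂unif01, 0 ≤ x ∧ x ≤ 1 :=
  ae_restrict_mem measurableSet_Icc

theorem lintegral_unif01 : ∫⁻ x, ENNReal.ofReal x ∂unif01 = 2⁻¹ := by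
  rw [← ofReal_integral_eq_lintegral_ofReal, unif01, integral_Icc_eq_integral_Ioc,
    ← intervalIntegral.integral_of_le zero_le_one, integral_id]
  · rw [show ((1 : ℝ) ^ 2 - 0 ^ 2) / 2 = 2⁻¹ by norm_num, ENNReal.ofReal_inv_of_pos two_pos]
    simp
  · exact (continuous_id.integrableOn_Icc)
  · filter_upwards [ae_unif01] with x hx using hx.1

theorem lintegral_unif01_compl : ∫⁻ x, ENNReal.ofReal (1 - x) ∂unif01 = 2⁻¹ := by
  rw [← ofReal_integral_eq_lintegral_ofReal, unif01, integral_Icc_eq_integral_Ioc,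
    ← intervalIntegral.integral_of_le zero_le_one]
  · rw [show (∫ x in (0:ℝ)..1, (1 - x)) = 2⁻¹ by
        rw [intervalIntegral.integral_sub (by simp) (by simp)]; norm_num [integral_id],
      ENNReal.ofReal_inv_of_pos two_pos]
    simp
  · exact (by fun_prop : Continuous fun x : ℝ => 1 - x).integrableOn_Icc
  · filter_upwards [ae_unif01] with x hx using sub_nonneg.2 hx.2

@[fun_prop]
theorem Measurable.trunc {α : Type*} [MeasurableSpace α] {f : α → ℤ → ℝ} (hf : Measurable f)
    (N : ℕ) : Measurable fun a => trunc N (f a) := by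
  refine measurable_pi_iff.2 fun i => ?_
  unfold _root_.trunc
  split_ifs <;> fun_prop

@[fun_prop]
theorem Measurable.siloStep {α : Type*} [MeasurableSpace α] {u v w : α → ℤ → ℝ}
    (hu : Measurable u) (hv : Measurable v) (hw : Measurable w) (N : ℕ) :
    Measurable fun a => siloStep N (u a) (v a) (w a) := by
  have h : ∀ i, Measurable fun a => _root_.trunc N (w a) i := fun i =>
    (measurable_pi_apply i).comp (hw.trunc N)
  refine Measurable.trunc (measurable_pi_iff.2 fun i => ?_) N
  have := h (i + 1)
  have := h (i - 1)
  fun_prop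

theorem trunc_nonneg {N : ℕ} {w : ℤ → ℝ} (hw : ∀ i, 0 ≤ w i) (i : ℤ) : 0 ≤ trunc N w i := by
  unfold trunc
  split_ifs
  exacts [hw i, le_rfl]

/-- The excess at site `i` of `x`, translated by `s` to the right, over `y`. -/
def siloExcess (M N : ℕ) (s : ℤ) (x y : ℤ → ℝ) (i : ℤ) : ENNReal :=
  ENNReal.ofReal (trunc M x (i - s) - trunc N y i)

/-- A concave weight on `ℤ` supported by the box `{1,…,N}`. -/
def siloWeight (N : ℕ) (i : ℤ) : ENNReal := ENNReal.ofReal ((i : ℝ) * (N + 1 - i))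

/-- The weighted total excess. -/
def siloLyapunov (M N : ℕ) (s : ℤ) (p : (ℤ → ℝ) × (ℤ → ℝ)) : ENNReal :=
  ∑' i : ℤ, siloWeight N i * siloExcess M N s p.1 p.2 i

/-- The contraction rate of `siloLyapunov`. -/
def siloRate (N : ℕ) : ENNReal := ENNReal.ofReal (1 - 1 / ((N : ℝ) + 1) ^ 2)

theorem siloRate_lt_one (N : ℕ) : siloRate N < 1 := by
  rw [siloRate, ENNReal.ofReal_lt_one]
  have : 0 < 1 / ((N : ℝ) + 1) ^ 2 := by positivity
  linarith

theorem siloWeight_contract {N : ℕ} {j : ℤ} (h1 : 1 ≤ j) (hN : j ≤ N) :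
    siloWeight N (j - 1) * 2⁻¹ + siloWeight N (j + 1) * 2⁻¹ ≤ siloRate N * siloWeight N j := by
  have h1' : (1 : ℝ) ≤ j := by exact_mod_cast h1
  have hN' : (j : ℝ) ≤ N := by exact_mod_cast hN
  have hhalf : (2⁻¹ : ENNReal) = ENNReal.ofReal 2⁻¹ := by
    rw [ENNReal.ofReal_inv_of_pos two_pos]; simp
  have hq : 1 / ((N : ℝ) + 1) ^ 2 * ((j : ℝ) * (N + 1 - j)) ≤ 1 := by
    rw [one_div, inv_mul_le_one₀ (by positivity)]
    nlinarith
  have hr : 0 ≤ 1 - 1 / ((N : ℝ) + 1) ^ 2 := by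
    rw [sub_nonneg, div_le_one (by positivity)]
    nlinarith
  have ha : 0 ≤ ((j : ℝ) - 1) * (N + 1 - (j - 1)) := mul_nonneg (by linarith) (by linarith)
  have hb : 0 ≤ ((j : ℝ) + 1) * (N + 1 - (j + 1)) := mul_nonneg (by linarith) (by linarith)
  simp only [siloWeight, siloRate, hhalf]
  push_cast
  rw [← ENNReal.ofReal_mul ha, ← ENNReal.ofReal_mul hb, ← ENNReal.ofReal_mul hr,
    ← ENNReal.ofReal_add (by positivity) (by positivity)]
  refine ENNReal.ofReal_le_ofReal ?_
  nlinarith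

theorem siloExcess_eq_zero {M N : ℕ} {s : ℤ} (hs : 0 ≤ s) (hMN : M + s ≤ N) {x y : ℤ → ℝ}
    (hy : ∀ i, 0 ≤ y i) {i : ℤ} (hi : ¬ (1 ≤ i ∧ i ≤ (N : ℤ))) :
    siloExcess M N s x y i = 0 := by
  have : trunc M x (i - s) = 0 := if_neg (by omega)
  rw [siloExcess, this, ENNReal.ofReal_eq_zero]
  linarith [trunc_nonneg (N := N) hy i]

/-- The coupled step: both silos use the same noise, the narrow one through its window. -/
def siloCoupledStep (M N : ℕ) (s : ℤ)
    (z : ((ℤ → ℝ) × (ℤ → ℝ)) × ((ℤ → ℝ) × (ℤ → ℝ))) : (ℤ → ℝ) × (ℤ → ℝ) :=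
  (siloStep M (windowShift s (Finset.Icc 0 ((M : ℤ) + 1)) z.2.1)
    (windowShift s (Finset.Icc 1 (M : ℤ)) z.2.2) z.1.1, siloStep N z.2.1 z.2.2 z.1.2)

theorem measurable_siloCoupledStep (M N : ℕ) (s : ℤ) : Measurable (siloCoupledStep M N s) := by
  unfold siloCoupledStep
  fun_prop

theorem trunc_trunc (N : ℕ) (w : ℤ → ℝ) (i : ℤ) : trunc N (trunc N w) i = trunc N w i := by
  simp only [trunc]
  split_ifs <;> rfl

theorem siloExcess_coupledStep_le {M N : ℕ} {s : ℤ} (hs : 0 ≤ s) (hMN : M + s ≤ N)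
    {x y u v : ℤ → ℝ} (hy : ∀ i, 0 ≤ y i) (hu : ∀ i, 0 ≤ u i ∧ u i ≤ 1) (hv : ∀ i, 0 ≤ v i)
    (i : ℤ) :
    siloExcess M N s (siloCoupledStep M N s ((x, y), (u, v))).1
        (siloCoupledStep M N s ((x, y), (u, v))).2 i ≤
      siloExcess M N s x y (i + 1) * ENNReal.ofReal (u (i + 1)) +
        siloExcess M N s x y (i - 1) * ENNReal.ofReal (1 - u (i - 1)) := by
  have hstep : 0 ≤ siloStep N u v y i := trunc_nonneg (fun j => by
    have h1 := mul_nonneg (trunc_nonneg (N := N) hy (j + 1)) (hu (j + 1)).1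
    have h2 := mul_nonneg (trunc_nonneg (N := N) hy (j - 1)) (sub_nonneg.2 (hu (j - 1)).2)
    linarith [hv j]) i
  simp only [siloExcess, siloCoupledStep]
  rw [siloStep, siloStep, trunc_trunc, trunc_trunc]
  rw [siloStep] at hstep
  by_cases hi : 1 ≤ i - s ∧ i - s ≤ (M : ℤ)
  · have hi' : 1 ≤ i ∧ i ≤ (N : ℤ) := by omega
    have hin : ∀ (K : ℕ) (w : ℤ → ℝ) (j : ℤ), 1 ≤ j ∧ j ≤ (K : ℤ) → trunc K w j = w j :=
      fun _ _ _ hj => if_pos hj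
    rw [hin M _ _ hi, hin N _ _ hi', windowShift, if_pos (by simp; omega), windowShift, if_pos (by simp; omega), windowShift,
      if_pos (by simp; omega), show i - s + s = i by ring, show i - s + 1 + s = i + 1 by ring,
      show i - s - 1 + s = i - 1 by ring, show i - s + 1 = i + 1 - s by ring,
      show i - s - 1 = i - 1 - s by ring, ← ENNReal.ofReal_mul' (hu _).1,
      ← ENNReal.ofReal_mul' (sub_nonneg.2 (hu _).2)]
    refine le_trans (ENNReal.ofReal_le_ofReal (le_of_eq ?_)) ENNReal.ofReal_add_le
    ring
  · have h0 : ∀ w, trunc M w (i - s) = 0 := fun w => if_neg hi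
    rw [h0, ENNReal.ofReal_of_nonpos (by linarith)]
    exact zero_le

theorem siloLyapunov_coupledStep_le {M N : ℕ} {s : ℤ} (hs : 0 ≤ s) (hMN : M + s ≤ N)
    {x y u v : ℤ → ℝ} (hy : ∀ i, 0 ≤ y i) (hu : ∀ i, 0 ≤ u i ∧ u i ≤ 1) (hv : ∀ i, 0 ≤ v i) :
    siloLyapunov M N s (siloCoupledStep M N s ((x, y), (u, v))) ≤
      ∑' j : ℤ, siloExcess M N s x y j * (siloWeight N (j - 1) * ENNReal.ofReal (u j) +
        siloWeight N (j + 1) * ENNReal.ofReal (1 - u j)) := by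
  have hA := (Equiv.addRight (1 : ℤ)).tsum_eq fun j =>
    siloWeight N (j - 1) * (siloExcess M N s x y j * ENNReal.ofReal (u j))
  have hB := (Equiv.subRight (1 : ℤ)).tsum_eq fun j =>
    siloWeight N (j + 1) * (siloExcess M N s x y j * ENNReal.ofReal (1 - u j))
  simp only [Equiv.coe_addRight, Equiv.subRight_apply, add_sub_cancel_right,
    sub_add_cancel] at hA hB
  calc _ ≤ ∑' i : ℤ, siloWeight N i *
        (siloExcess M N s x y (i + 1) * ENNReal.ofReal (u (i + 1)) +
        siloExcess M N s x y (i - 1) * ENNReal.ofReal (1 - u (i - 1))) :=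
        ENNReal.tsum_le_tsum fun i => by
          gcongr
          exact siloExcess_coupledStep_le hs hMN hy hu hv i
    _ = _ := by
        simp only [mul_add]
        rw [ENNReal.tsum_add, hA, hB, ← ENNReal.tsum_add]
        refine tsum_congr fun j => ?_
        ring

instance (N : ℕ) (νV : Measure ℝ) [IsProbabilityMeasure νV] :
    IsProbabilityMeasure (siloDriveLaw N νV) := by
  unfold siloDriveLaw
  infer_instance

theorem ae_siloDriveLaw (N : ℕ) {νV : Measure ℝ} (hV : IsVLaw νV) :
    ∀ᵐ q ∂siloDriveLaw N νV, (∀ i, 0 ≤ q.1 i ∧ q.1 i ≤ 1) ∧ ∀ i, 0 ≤ q.2 i := by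
  have := hV.1
  have hpos : ∀ᵐ x ∂νV, 0 ≤ x := by
    rw [ae_iff]
    simpa using hV.2.1
  refine Eventually.and ?_ ?_
  · exact Measure.quasiMeasurePreserving_fst.ae (ae_finExtLaw ae_unif01 (by simp))
  · exact Measure.quasiMeasurePreserving_snd.ae (ae_finExtLaw hpos le_rfl)

theorem lintegral_siloDriveLaw_fst {N : ℕ} {νV : Measure ℝ} [IsProbabilityMeasure νV] {j : ℤ}
    (hj : 1 ≤ j ∧ j ≤ (N : ℤ)) {g : ℝ → ENNReal} (hg : Measurable g) :
    ∫⁻ q, g (q.1 j) ∂siloDriveLaw N νV = ∫⁻ x, g x ∂unif01 := by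
  rw [siloDriveLaw, lintegral_prod _ (by fun_prop)]
  simp only [lintegral_const, measure_univ, mul_one]
  rw [← finExtLaw_map_eval (I := Finset.Icc 0 ((N : ℤ) + 1)) (i := j) unif01 (by simp; omega),
    lintegral_map hg (by fun_prop)]
  rw [finExtLaw_map_eval unif01 (by simp; omega)]

theorem lintegral_siloLyapunov_coupledStep_le {M N : ℕ} {s : ℤ} (hs : 0 ≤ s) (hMN : M + s ≤ N)
    {νV : Measure ℝ} (hV : IsVLaw νV) {x y : ℤ → ℝ} (hy : ∀ i, 0 ≤ y i) :
    ∫⁻ q, siloLyapunov M N s (siloCoupledStep M N s ((x, y), q)) ∂siloDriveLaw N νV ≤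
      siloRate N * siloLyapunov M N s (x, y) := by
  have := hV.1
  calc _ ≤ ∫⁻ q, ∑' j : ℤ, siloExcess M N s x y j *
          (siloWeight N (j - 1) * ENNReal.ofReal (q.1 j) +
            siloWeight N (j + 1) * ENNReal.ofReal (1 - q.1 j)) ∂siloDriveLaw N νV := by
        refine lintegral_mono_ae ?_
        filter_upwards [ae_siloDriveLaw N hV] with q hq
        exact siloLyapunov_coupledStep_le hs hMN hy hq.1 hq.2
    _ = ∑' j : ℤ, siloExcess M N s x y j * ∫⁻ q,
          (siloWeight N (j - 1) * ENNReal.ofReal (q.1 j) +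
            siloWeight N (j + 1) * ENNReal.ofReal (1 - q.1 j)) ∂siloDriveLaw N νV := by
        rw [lintegral_tsum fun j => by fun_prop]
        refine tsum_congr fun j => ?_
        rw [lintegral_const_mul _ (by fun_prop)]
    _ ≤ ∑' j : ℤ, siloExcess M N s x y j * (siloRate N * siloWeight N j) := by
        refine ENNReal.tsum_le_tsum fun j => ?_
        by_cases hj : 1 ≤ j ∧ j ≤ (N : ℤ)
        · gcongr
          rw [lintegral_add_left (by fun_prop), lintegral_const_mul _ (by fun_prop),
            lintegral_const_mul _ (by fun_prop),
            lintegral_siloDriveLaw_fst hj ENNReal.measurable_ofReal,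
            lintegral_siloDriveLaw_fst hj (g := fun x => ENNReal.ofReal (1 - x)) (by fun_prop),
            lintegral_unif01, lintegral_unif01_compl]
          exact siloWeight_contract hj.1 hj.2
        · rw [siloExcess_eq_zero hs hMN hy hj, zero_mul, zero_mul]
    _ = _ := by
        rw [siloLyapunov, ← ENNReal.tsum_mul_left]
        refine tsum_congr fun j => ?_
        ring

theorem measurable_siloLyapunov (M N : ℕ) (s : ℤ) : Measurable (siloLyapunov M N s) := by
  unfold siloLyapunov siloExcess
  refine Measurable.tsum fun i => ?_
  have h1 : Measurable fun p : (ℤ → ℝ) × (ℤ → ℝ) => trunc M p.1 (i - s) :=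
    (measurable_pi_apply (i - s)).comp (measurable_fst.trunc M)
  have h2 : Measurable fun p : (ℤ → ℝ) × (ℤ → ℝ) => trunc N p.2 i :=
    (measurable_pi_apply i).comp (measurable_snd.trunc N)
  fun_prop

theorem siloDriveLaw_map_windowShift {M N : ℕ} {s : ℤ} (hs : 0 ≤ s) (hMN : M + s ≤ N)
    (νV : Measure ℝ) [IsProbabilityMeasure νV] :
    (siloDriveLaw N νV).map (Prod.map (windowShift s (Finset.Icc 0 ((M : ℤ) + 1)))
      (windowShift s (Finset.Icc 1 (M : ℤ)))) = siloDriveLaw M νV := by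
  rw [siloDriveLaw, ← Measure.map_prod_map _ _ (by fun_prop) (by fun_prop),
    finExtLaw_map_windowShift (by simp; omega), finExtLaw_map_windowShift (by simp; omega),
    siloDriveLaw]

theorem SiloSupported.ae {N : ℕ} {μ : Measure (ℤ → ℝ)} [IsProbabilityMeasure μ]
    (h : SiloSupported N μ) :
    ∀ᵐ w ∂μ, ∀ i : ℤ, 0 ≤ w i ∧ (¬(1 ≤ i ∧ i ≤ (N : ℤ)) → w i = 0) := by
  refine (mem_ae_iff_prob_eq_one ?_).2 h
  rw [Set.ofPred_forall]
  refine MeasurableSet.iInter fun i => ?_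
  by_cases hi : 1 ≤ i ∧ i ≤ (N : ℤ)
  · simpa only [hi, not_true_eq_false, false_imp_iff, and_true] using
      measurableSet_le measurable_const (measurable_pi_apply i)
  · simpa only [hi, not_false_eq_true, forall_const, Set.ofPred_and] using
      (measurableSet_le measurable_const (measurable_pi_apply i)).inter
        (measurableSet_eq_fun (measurable_pi_apply i) measurable_const)

/-- Running the coupled dynamics for `n` steps from the independent coupling. -/
theorem exists_silo_coupling {M N : ℕ} {s : ℤ} (hs : 0 ≤ s) (hMN : M + s ≤ N)
    {νV : Measure ℝ} (hV : IsVLaw νV) {μ μ' : Measure (ℤ → ℝ)}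
    (hμ : IsSiloInvariant M νV μ) (hμ' : IsSiloInvariant N νV μ') (n : ℕ) :
    ∃ π : Measure ((ℤ → ℝ) × (ℤ → ℝ)), π.map Prod.fst = μ ∧ π.map Prod.snd = μ' ∧
      ∀ c : ENNReal, ∫⁻ p, min (c * siloLyapunov M N s p) 1 ∂π ≤
        ∫⁻ p, min (c * siloRate N ^ n * siloLyapunov M N s p) 1 ∂(μ.prod μ') := by
  have := hV.1
  have := hμ.1
  have := hμ'.1
  have hL := measurable_siloLyapunov M N s
  have hT := measurable_siloCoupledStep M N s
  induction n with
  | zero => exact ⟨μ.prod μ', by simp, by simp, fun c => by simp⟩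
  | succ n ih =>
    obtain ⟨π, h1, h2, h3⟩ := ih
    have hπ : IsProbabilityMeasure π :=
      ⟨by rw [← Set.preimage_univ (f := Prod.fst),
        ← Measure.map_apply measurable_fst MeasurableSet.univ, h1, measure_univ]⟩
    refine ⟨(π.prod (siloDriveLaw N νV)).map (siloCoupledStep M N s), ?_, ?_, fun c => ?_⟩
    · rw [Measure.map_map measurable_fst hT]
      conv_rhs => rw [← hμ.2.2, ← siloDriveLaw_map_windowShift hs hMN, ← h1,
        Measure.map_prod_map _ _ (by fun_prop) (by fun_prop),
        Measure.map_map (by fun_prop) (by fun_prop)]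
      rfl
    · rw [Measure.map_map measurable_snd hT]
      conv_rhs => rw [← hμ'.2.2, ← h2, ← Measure.map_id (μ := siloDriveLaw N νV),
        Measure.map_prod_map _ _ (by fun_prop) (by fun_prop),
        Measure.map_map (by fun_prop) (by fun_prop)]
      rfl
    · have hy : ∀ᵐ p ∂π, ∀ i, 0 ≤ p.2 i := by
        have := hμ'.2.1.ae
        rw [← h2] at this
        filter_upwards [ae_of_ae_map (by fun_prop) this] with p hp i using (hp i).1
      rw [lintegral_map (by fun_prop) hT, lintegral_prod _ (by fun_prop)]
      calc _ ≤ ∫⁻ p, min (c * siloRate N * siloLyapunov M N s p) 1 ∂π := by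
            refine lintegral_mono_ae ?_
            filter_upwards [hy] with p hp
            refine le_min ?_ ?_
            · refine (lintegral_mono fun q => min_le_left _ _).trans ?_
              rw [lintegral_const_mul _ (by fun_prop), mul_assoc]
              gcongr
              exact lintegral_siloLyapunov_coupledStep_le hs hMN hV hp
            · exact (lintegral_mono fun q => min_le_right _ _).trans (by simp)
        _ ≤ _ := (h3 _).trans_eq (by simp only [pow_succ', mul_assoc])

theorem siloLyapunov_ne_top {M N : ℕ} {s : ℤ} (hs : 0 ≤ s) (hMN : M + s ≤ N)
    {p : (ℤ → ℝ) × (ℤ → ℝ)} (hy : ∀ i, 0 ≤ p.2 i) : siloLyapunov M N s p ≠ ⊤ := by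
  rw [siloLyapunov, tsum_eq_sum (s := Finset.Icc 1 (N : ℤ)) fun j hj => by
    rw [siloExcess_eq_zero hs hMN hy (by simpa using hj), mul_zero]]
  exact ENNReal.sum_ne_top.2 fun i _ => ENNReal.mul_ne_top ENNReal.ofReal_ne_top
    ENNReal.ofReal_ne_top

theorem siloExcess_le_siloLyapunov {M N : ℕ} {s : ℤ} {p : (ℤ → ℝ) × (ℤ → ℝ)} {i : ℤ}
    (hi : 1 ≤ i ∧ i ≤ (N : ℤ)) : siloExcess M N s p.1 p.2 i ≤ siloLyapunov M N s p := by
  have hw : 1 ≤ siloWeight N i := by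
    have h1 : (1 : ℝ) ≤ i := by exact_mod_cast hi.1
    have h2 : (i : ℝ) ≤ N := by exact_mod_cast hi.2
    rw [siloWeight, ENNReal.one_le_ofReal]
    nlinarith
  calc _ ≤ siloWeight N i * siloExcess M N s p.1 p.2 i := le_mul_of_one_le_left zero_le hw
    _ ≤ _ := ENNReal.le_tsum (f := fun i => siloWeight N i * siloExcess M N s p.1 p.2 i) i

/-- A narrow silo placed inside a wide one has the smaller invariant measure. -/
theorem IsSiloInvariant.stochLE {M N : ℕ} {s : ℤ} (hs : 0 ≤ s) (hMN : M + s ≤ N)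
    {νV : Measure ℝ} (hV : IsVLaw νV) {μ μ' : Measure (ℤ → ℝ)}
    (hμ : IsSiloInvariant M νV μ) (hμ' : IsSiloInvariant N νV μ') :
    StochLE (μ.map fun w i => w (i - s)) μ' := by
  have := hV.1
  have := hμ.1
  have := hμ'.1
  have hL := measurable_siloLyapunov M N s
  have hsh : Measurable fun (w : ℤ → ℝ) i => w (i - s) := by fun_prop
  have := Measure.isProbabilityMeasure_map (μ := μ) hsh.aemeasurable
  have hlim : Tendsto (fun n : ℕ =>
      ∫⁻ p, min (siloRate N ^ n * siloLyapunov M N s p) 1 ∂(μ.prod μ')) atTop (nhds 0) := by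
    rw [← lintegral_zero (μ := μ.prod μ')]
    refine tendsto_lintegral_of_dominated_convergence (fun _ => 1) (fun n => by fun_prop)
      (fun n => Eventually.of_forall fun p => min_le_right _ _) (by simp) ?_
    filter_upwards [Measure.quasiMeasurePreserving_snd.ae hμ'.2.1.ae] with p hp
    have hpow := ENNReal.Tendsto.mul_const
      (ENNReal.tendsto_pow_atTop_nhds_zero_of_lt_one (siloRate_lt_one N))
      (Or.inr (siloLyapunov_ne_top hs hMN fun i => (hp i).1))
    rw [zero_mul] at hpow
    exact tendsto_of_tendsto_of_tendsto_of_le_of_le tendsto_const_nhds hpow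
      (fun _ => zero_le) fun _ => min_le_left _ _
  refine StochLE.of_approx_coupling fun ε hε δ hδ => ?_
  have hη : (0 : ℝ) < min ε 1 := lt_min hε one_pos
  have hη0 : ENNReal.ofReal (min ε 1) ≠ 0 := by simpa using hη
  obtain ⟨n, hn⟩ := (hlim.eventually_lt_const
    (ENNReal.mul_pos hη0 hδ.ne')).exists
  obtain ⟨π, h1, h2, h3⟩ := exists_silo_coupling hs hMN hV hμ hμ' n
  refine ⟨π.map (Prod.map (fun w i => w (i - s)) id), ?_, ?_, ?_⟩
  · rw [Measure.map_map (by fun_prop) (by fun_prop), ← h1,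
      Measure.map_map (by fun_prop) (by fun_prop)]
    rfl
  · rw [Measure.map_map (by fun_prop) (by fun_prop), ← h2]
    rfl
  have hset : MeasurableSet {p : (ℤ → ℝ) × (ℤ → ℝ) | ¬ ∀ i, p.1 i ≤ p.2 i + ε} := by
    have hInter : MeasurableSet (⋂ i, {p : (ℤ → ℝ) × (ℤ → ℝ) | p.1 i ≤ p.2 i + ε}) :=
      MeasurableSet.iInter fun i => measurableSet_le (by fun_prop) (by fun_prop)
    convert hInter.compl
    ext p
    simp
  rw [Measure.map_apply (by fun_prop) hset]
  have hx := hμ.2.1.ae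
  rw [← h1] at hx
  have hy := hμ'.2.1.ae
  rw [← h2] at hy
  have hbad : π (Prod.map (fun w i => w (i - s)) id ⁻¹'
      {p : (ℤ → ℝ) × (ℤ → ℝ) | ¬ ∀ i, p.1 i ≤ p.2 i + ε}) ≤
      π {p | ENNReal.ofReal (min ε 1) ≤ min (1 * siloLyapunov M N s p) 1} := by
    refine measure_mono_ae ?_
    filter_upwards [ae_of_ae_map (by fun_prop) hx, ae_of_ae_map (by fun_prop) hy]
      with p hpx hpy hp
    have htr : ∀ (K : ℕ) (w : ℤ → ℝ),
        (∀ i : ℤ, 0 ≤ w i ∧ (¬(1 ≤ i ∧ i ≤ (K : ℤ)) → w i = 0)) →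
        ∀ i, trunc K w i = w i := by
      intro K w hw i
      unfold trunc
      split_ifs with h
      exacts [rfl, ((hw i).2 h).symm]
    obtain ⟨i, hi⟩ := not_forall.1 (show ¬ ∀ i, p.1 (i - s) ≤ p.2 i + ε from hp)
    rw [not_le] at hi
    have hbox : 1 ≤ i ∧ i ≤ (N : ℤ) := by
      by_contra hb
      have h0 := (hpx (i - s)).2 (by omega)
      linarith [(hpy i).1]
    refine le_min ?_ (ENNReal.ofReal_le_one.2 (min_le_right _ _))
    rw [one_mul]
    refine le_trans (ENNReal.ofReal_le_ofReal ?_) (siloExcess_le_siloLyapunov hbox)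
    rw [htr M _ hpx, htr N _ hpy]
    linarith [min_le_left ε 1]
  have hmarkov := mul_meas_ge_le_lintegral₀ (μ := π)
    (f := fun p => min (1 * siloLyapunov M N s p) 1) (by fun_prop) (ENNReal.ofReal (min ε 1))
  have h3' := h3 1
  rw [one_mul] at h3'
  refine hbad.trans ((ENNReal.mul_le_mul_iff_right hη0 ENNReal.ofReal_ne_top).1 ?_)
  exact hmarkov.trans (h3'.trans hn.le)

theorem StochLE.map_shift1 {μ μ' : Measure (ℤ → ℝ)} (h : StochLE μ μ') :
    StochLE (μ.map shift1) (μ'.map shift1) := by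
  have hm : Measurable shift1 := by unfold shift1; fun_prop
  intro f hf ⟨C, hC⟩ hmono
  rw [integral_map hm.aemeasurable hf.aestronglyMeasurable,
    integral_map hm.aemeasurable hf.aestronglyMeasurable]
  exact h (f ∘ shift1) (hf.comp hm) ⟨C, fun w => hC _⟩
    fun w w' hw => hmono _ _ fun i => hw _

/-- Monotonicity in the width of the silo: for `N ≥ 3`, the invariant measures of the
silos of widths `N-2`, `N`, `N+2` (extended by zero outside their boxes) satisfy
`τ₁ μ^{N-2} ≤st μ^N ≤st μ^{N+2}` and `τ₁ μ^{N-2} ≤st τ₁ μ^N ≤st μ^{N+2}`. -/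
theorem silo_invariant_measures_stochastically_ordered
    (νV : Measure ℝ) (hνV : IsVLaw νV) (N : ℕ) (hN : 3 ≤ N)
    (μa μb μc : Measure (ℤ → ℝ))
    (hμa : IsSiloInvariant (N - 2) νV μa) (hμb : IsSiloInvariant N νV μb)
    (hμc : IsSiloInvariant (N + 2) νV μc) :
    (StochLE (μa.map shift1) μb ∧ StochLE μb μc) ∧
      (StochLE (μa.map shift1) (μb.map shift1) ∧ StochLE (μb.map shift1) μc) := by
  have h0 : ∀ {K L : ℕ} {μ μ' : Measure (ℤ → ℝ)}, K ≤ L → IsSiloInvariant K νV μ →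
      IsSiloInvariant L νV μ' → StochLE μ μ' := by
    intro K L μ μ' hKL hμ hμ'
    simpa using IsSiloInvariant.stochLE (s := 0) le_rfl (by omega) hνV hμ hμ'
  have h1 : ∀ {K L : ℕ} {μ μ' : Measure (ℤ → ℝ)}, K + 1 ≤ L → IsSiloInvariant K νV μ →
      IsSiloInvariant L νV μ' → StochLE (μ.map shift1) μ' := fun hKL hμ hμ' =>
    IsSiloInvariant.stochLE (s := 1) zero_le_one (by omega) hνV hμ hμ'
  exact ⟨⟨h1 (by omega) hμa hμb, h0 (by omega) hμb hμc⟩,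
    (h0 (by omega) hμa hμb).map_shift1, h1 (by omega) hμb hμc⟩
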